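/- Let (X, d) be a metric space, let α, β, γ, δ, ε, ζ : X×X → ℝ, let T : X → X be an (α, β, γ, δ, ε, ζ)-weighted generalized pseudocontraction, let λ : X×X → [0,1], and let A ∈ (0,1). Suppose that for all x, y ∈ X, at least one of the following holds: (i) α_λ(x,y) + ζ_λ(x,y) + 2·min{β_λ(x,y), 0} > 0 and −(δ_λ(x,y) + ε_λ(x,y) + 2·min{β_λ(x,y), 0})/(α_λ(x,y) + ζ_λ(x,y) + 2·min{β_λ(x,y), 0}) ≤ A; or (ii) α_λ(y,x) + ε_λ(y,x) + 2·min{γ_λ(y,x), 0} > 0 and −(δ_λ(y,x) + ζ_λ(y,x) + 2·min{γ_λ(y,x), 0})/(α_λ(y,x) + ε_λ(y,x) + 2·min{γ_λ(y,x), 0}) ≤ A. Then for every x ∈ X and every n ∈ ℕ, d(Tⁿx, Tⁿ⁺¹x)² ≤ Aⁿ·d(x, Tx)². -/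

import Mathlib

open Filter Topology

/-- `T` is an `(α, β, γ, δ, ε, ζ)`-weighted generalized pseudocontraction. -/
def IsWGPseudocontraction {X : Type*} [MetricSpace X]
    (T : X → X) (α β γ δ ε ζ : X → X → ℝ) : Prop :=
  ∀ x y : X,
    α x y * dist (T x) (T y) ^ 2 + β x y * dist x (T y) ^ 2 +
      γ x y * dist (T x) y ^ 2 + δ x y * dist x y ^ 2 +
      ε x y * dist x (T x) ^ 2 + ζ x y * dist y (T y) ^ 2 ≤ 0

/-- The `l`-weighted combination of two coefficient maps:
`(f, g) ↦ (x, y) ↦ (1 − l(x,y))·f(x,y) + l(x,y)·g(y,x)`.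
With it: `α_λ = wComb l α α`, `β_λ = wComb l β γ`, `γ_λ = wComb l γ β`,
`δ_λ = wComb l δ δ`, `ε_λ = wComb l ε ζ`, `ζ_λ = wComb l ζ ε`. -/
def wComb {X : Type*} (l f g : X → X → ℝ) : X → X → ℝ :=
  fun x y => (1 - l x y) * f x y + l x y * g y x

/-- The weighted inequality is inherited by the `l`-weighted combinations of the coefficients. -/
theorem IsWGPseudocontraction.wComb {X : Type*} [MetricSpace X] {T : X → X}
    {α β γ δ ε ζ : X → X → ℝ} (hT : IsWGPseudocontraction T α β γ δ ε ζ)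
    {l : X → X → ℝ} (hl : ∀ x y : X, l x y ∈ Set.Icc (0 : ℝ) 1) :
    IsWGPseudocontraction T (wComb l α α) (wComb l β γ) (wComb l γ β) (wComb l δ δ)
      (wComb l ε ζ) (wComb l ζ ε) := by
  intro x y
  obtain ⟨h0, h1⟩ := hl x y
  have hxy := mul_nonpos_of_nonneg_of_nonpos (sub_nonneg.2 h1) (hT x y)
  have hyx := mul_nonpos_of_nonneg_of_nonpos h0 (hT y x)
  rw [dist_comm (T y) (T x), dist_comm y (T x), dist_comm (T y) x, dist_comm y x] at hyx
  simp only [_root_.wComb]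
  linarith

theorem sq_le_mul_sq_of_weighted_le {a b c p q r A : ℝ} (hr : 0 ≤ r) (hrpq : r ≤ p + q)
    (h : a * q ^ 2 + b * r ^ 2 + c * p ^ 2 ≤ 0) (hpos : 0 < a + 2 * min b 0)
    (hA : -((c + 2 * min b 0) / (a + 2 * min b 0)) ≤ A) : q ^ 2 ≤ A * p ^ 2 := by
  have hr2 : r ^ 2 ≤ 2 * (p ^ 2 + q ^ 2) :=
    (pow_le_pow_left₀ hr hrpq 2).trans add_sq_le
  have hb : min b 0 * (2 * (p ^ 2 + q ^ 2)) ≤ b * r ^ 2 :=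
    (mul_le_mul_of_nonpos_left hr2 (min_le_right b 0)).trans
      (mul_le_mul_of_nonneg_right (min_le_left b 0) (sq_nonneg r))
  rw [← neg_div, div_le_iff₀ hpos] at hA
  have hp := mul_le_mul_of_nonneg_right hA (sq_nonneg p)
  refine le_of_mul_le_mul_left ?_ hpos
  linarith

theorem stmt_7 {X : Type*} [MetricSpace X] (α β γ δ ε ζ : X → X → ℝ)
    (T : X → X) (hT : IsWGPseudocontraction T α β γ δ ε ζ)
    (l : X → X → ℝ) (hl : ∀ x y : X, l x y ∈ Set.Icc (0 : ℝ) 1)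
    (A : ℝ) (hA : A ∈ Set.Ioo (0 : ℝ) 1)
    (h : ∀ x y : X,
        (0 < wComb l α α x y + wComb l ζ ε x y + 2 * min (wComb l β γ x y) 0 ∧
          -((wComb l δ δ x y + wComb l ε ζ x y + 2 * min (wComb l β γ x y) 0) /
              (wComb l α α x y + wComb l ζ ε x y + 2 * min (wComb l β γ x y) 0)) ≤ A) ∨
        (0 < wComb l α α y x + wComb l ε ζ y x + 2 * min (wComb l γ β y x) 0 ∧
          -((wComb l δ δ y x + wComb l ζ ε y x + 2 * min (wComb l γ β y x) 0) /
              (wComb l α α y x + wComb l ε ζ y x + 2 * min (wComb l γ β y x) 0)) ≤ A)) :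
    ∀ (x : X) (n : ℕ),
      dist (T^[n] x) (T^[n + 1] x) ^ 2 ≤ A ^ n * dist x (T x) ^ 2 := by
  have hW := hT.wComb hl
  have step (x : X) : dist (T x) (T (T x)) ^ 2 ≤ A * dist x (T x) ^ 2 := by
    have htri := dist_triangle x (T x) (T (T x))
    rcases h x (T x) with ⟨hpos, hle⟩ | ⟨hpos, hle⟩
    · refine sq_le_mul_sq_of_weighted_le dist_nonneg htri ?_ hpos hle
      have := hW x (T x)
      rw [dist_self] at this
      linarith
    · refine sq_le_mul_sq_of_weighted_le dist_nonneg htri ?_ hpos hle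
      have := hW (T x) x
      rw [dist_self, dist_comm (T (T x)) (T x), dist_comm (T (T x)) x,
        dist_comm (T x) x] at this
      linarith
  intro x n
  induction n with
  | zero => simp
  | succ n ih =>
    have hs := step (T^[n] x)
    simp only [Function.iterate_succ_apply'] at ih ⊢
    calc _ ≤ A * dist (T^[n] x) (T (T^[n] x)) ^ 2 := hs
      _ ≤ A * (A ^ n * dist x (T x) ^ 2) := mul_le_mul_of_nonneg_left ih hA.1.le
      _ = A ^ (n + 1) * dist x (T x) ^ 2 := by ring
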